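/- arXiv:2511.06435 — 3 statements merged into one kernel-verified Lean document; each statement's English description precedes it below -/
import Mathlib

section
/- The matrices I, w₀ = [[0,1],[1,0]], and g_k = [[1, 0],[√ε·ϖ^k, 1]] for k ∈ ℤ_{≥1} form a complete set of representatives for the double cosets 𝓑\K/𝓑: every element of K lies in 𝓑·g·𝓑 for exactly one matrix g in this list. -/
open Matrix

noncomputable section

/-- A 2×2 matrix over `E`. -/
abbrev Mat (E : Type) := Matrix (Fin 2) (Fin 2) E

/-- The context: `E/F` is the unramified quadratic extension of a finite extension `F` of
`ℚ_p` (`p` odd), encoded via the Galois involution `sig` (whose fixed field is `F`),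
the valuation `nu` (normalized by `nu ϖ = 1` for a uniformizer `ϖ` of `F`),
a square root `sqeps` of a non-square unit `eps = sqeps^2` of `O_F`, the residue-field
cardinality `q` of `F`, and an additive character `psi'` of `F` trivial on `p_F` and
nontrivial on `O_F`. -/
structure USetting (E : Type) [Field E] where
  sig : E →+* E
  nu : E → WithTop ℤ
  sqeps : E
  pi : E
  q : ℕ
  psi' : E → ℂ
  sig_invol : ∀ x, sig (sig x) = x
  sig_ne : ∃ x, sig x ≠ x
  nu_eq_top : ∀ x, nu x = ⊤ ↔ x = 0
  nu_mul : ∀ x y, nu (x * y) = nu x + nu y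
  nu_add : ∀ x y, min (nu x) (nu y) ≤ nu (x + y)
  nu_sig : ∀ x, nu (sig x) = nu x
  nu_pi : nu pi = 1
  sig_pi : sig pi = pi
  sig_sqeps : sig sqeps = - sqeps
  nu_sqeps : nu sqeps = 0
  eps_not_square : ∀ y, sig y = y → y * y ≠ sqeps * sqeps
  gen : ∀ x : E, ∃ a b, sig a = a ∧ sig b = b ∧ x = a + b * sqeps
  nu_two : nu 2 = 0
  charzero : ∀ n : ℕ, (n : E) = 0 → n = 0
  complete : ∀ f : ℕ → E, (∀ n : ℕ, ((n : ℤ) : WithTop ℤ) ≤ nu (f (n + 1) - f n)) →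
    ∃ L, ∀ n : ℕ, ((n : ℤ) : WithTop ℤ) ≤ nu (L - f n)
  res_card : ∃ R : Finset E, R.card = q ∧ (∀ x ∈ R, sig x = x ∧ 0 ≤ nu x) ∧
    ∀ y : E, sig y = y → 0 ≤ nu y → ∃! x, x ∈ R ∧ 1 ≤ nu (y - x)
  psi'_mul : ∀ x y, sig x = x → sig y = y → psi' (x + y) = psi' x * psi' y
  psi'_ne : ∀ x, sig x = x → psi' x ≠ 0
  psi'_triv : ∀ x, sig x = x → 1 ≤ nu x → psi' x = 1
  psi'_nontriv : ∃ x, sig x = x ∧ 0 ≤ nu x ∧ psi' x ≠ 1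

variable {E : Type} [Field E]

/-- The matrix `w₀ = [[0,1],[1,0]]`. -/
def w0 (E : Type) [Field E] : Mat E := !![0, 1; 1, 0]

/-- `G = U(1,1)(F)`. -/
def Gset (S : USetting E) : Set (Mat E) :=
  {g | (g.map ⇑S.sig)ᵀ * w0 E * g = w0 E}

/-- `K = G ∩ GL₂(O_E)`: entries in `O_E` and determinant in `O_E^×`. -/
def Kset (S : USetting E) : Set (Mat E) :=
  {g | g ∈ Gset S ∧ (∀ i j, 0 ≤ S.nu (g i j)) ∧ S.nu g.det = 0}

/-- The congruence filtration subgroup `K_n` (for `n ≥ 1`; `K_0 = K` as a set). -/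
def Kfil (S : USetting E) (n : ℤ) : Set (Mat E) :=
  {g | g ∈ Kset S ∧ ∀ i j, (n : WithTop ℤ) ≤ S.nu ((g - 1) i j)}

/-- `𝓑 = B ∩ K`, the upper triangular matrices in `K`. -/
def Bcal (S : USetting E) : Set (Mat E) := {g | g ∈ Kset S ∧ g 1 0 = 0}

/-- `E^1`, the norm-one elements of `E`. -/
def E1set (S : USetting E) : Set E := {x | x * S.sig x = 1}

/-- `O_F^×` as a subset of `E`. -/
def OFunits (S : USetting E) : Set E := {x | S.sig x = x ∧ S.nu x = 0}

/-- `O_E^×` as a subset of `E`. -/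
def OEunits (S : USetting E) : Set E := {x | S.nu x = 0}

/-- A character of `E^×`, encoded as a function `E → ℂ` multiplicative and
nonvanishing on nonzero elements. -/
def IsChar (χ : E → ℂ) : Prop :=
  (∀ x y : E, x ≠ 0 → y ≠ 0 → χ (x * y) = χ x * χ y) ∧ ∀ x : E, x ≠ 0 → χ x ≠ 0

/-- A group homomorphism `E^1 → ℂ^×`, encoded as a function `E → ℂ`. -/
def IsE1Hom (S : USetting E) (φ : E → ℂ) : Prop :=
  (∀ x ∈ E1set S, ∀ y ∈ E1set S, φ (x * y) = φ x * φ y) ∧ ∀ x ∈ E1set S, φ x ≠ 0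

/-- A homomorphism into `ℂ^×` on a subset of matrices. -/
def IsHomOn (A : Set (Mat E)) (Ψ : Mat E → ℂ) : Prop :=
  (∀ x ∈ A, ∀ y ∈ A, Ψ (x * y) = Ψ x * Ψ y) ∧ ∀ x ∈ A, Ψ x ≠ 0

/-- `1 + p_E^n`. -/
def onePE (S : USetting E) (n : ℤ) : Set E := {x | (n : WithTop ℤ) ≤ S.nu (x - 1)}

/-- `1 + p_F^n`. -/
def onePF (S : USetting E) (n : ℤ) : Set E :=
  {x | S.sig x = x ∧ (n : WithTop ℤ) ≤ S.nu (x - 1)}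

/-- `χ` is trivial on a set. -/
def TrivOn (χ : E → ℂ) (s : Set E) : Prop := ∀ x ∈ s, χ x = 1

/-- `χ` has depth `r`: trivial on `1+p_E^{r+1}` and (if `r ≥ 1`) nontrivial on `1+p_E^r`. -/
def HasDepth (S : USetting E) (χ : E → ℂ) (r : ℕ) : Prop :=
  TrivOn χ (onePE S ((r : ℤ) + 1)) ∧ (r = 0 ∨ ¬ TrivOn χ (onePE S (r : ℤ)))

/-- `χ` has true depth `r`: the depth of its restriction to `F^×` is `r`. -/
def HasTrueDepth (S : USetting E) (χ : E → ℂ) (r : ℕ) : Prop :=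
  TrivOn χ (onePF S ((r : ℤ) + 1)) ∧ (r = 0 ∨ ¬ TrivOn χ (onePF S (r : ℤ)))

/-- `χ` has minimal depth `r`: its depth and true depth both equal `r`. -/
def MinDepth (S : USetting E) (χ : E → ℂ) (r : ℕ) : Prop :=
  HasDepth S χ r ∧ HasTrueDepth S χ r

/-- Right translation action on functions. -/
def rho (g : Mat E) : (Mat E → ℂ) →ₗ[ℂ] (Mat E → ℂ) where
  toFun f := fun k => f (k * g)
  map_add' _ _ := rfl
  map_smul' _ _ := rfl

/-- The space `V_χ^{K_n}`: functions on `K` (extended by zero off `K`) satisfying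
`f(bk) = χ(b₁₁) f(k)` for `b ∈ 𝓑` and right `K_n`-invariance. -/
def Vsp (S : USetting E) (χ : E → ℂ) (n : ℤ) : Submodule ℂ (Mat E → ℂ) where
  carrier := {f | (∀ x, x ∉ Kset S → f x = 0) ∧
    (∀ b ∈ Bcal S, ∀ k ∈ Kset S, f (b * k) = χ (b 0 0) * f k) ∧
    (∀ k ∈ Kset S, ∀ g ∈ Kfil S n, f (k * g) = f k)}
  add_mem' := by
    rintro f g ⟨hf0, hf1, hf2⟩ ⟨hg0, hg1, hg2⟩
    refine ⟨fun x hx => ?_, fun b hb k hk => ?_, fun k hk g' hg' => ?_⟩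
    · simp [hf0 x hx, hg0 x hx]
    · simp only [Pi.add_apply, hf1 b hb k hk, hg1 b hb k hk]; ring
    · simp only [Pi.add_apply, hf2 k hk g' hg', hg2 k hk g' hg']
  zero_mem' := by
    refine ⟨fun x _ => rfl, fun b _ k _ => by simp, fun k _ g _ => rfl⟩
  smul_mem' := by
    rintro c f ⟨hf0, hf1, hf2⟩
    refine ⟨fun x hx => ?_, fun b hb k hk => ?_, fun k hk g' hg' => ?_⟩
    · simp [hf0 x hx]
    · simp only [Pi.smul_apply, hf1 b hb k hk, smul_eq_mul]; ring
    · simp only [Pi.smul_apply, hf2 k hk g' hg']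

/-- The space of the representation induced from a character `Ψ` of a subgroup `H ⊆ K`:
functions on `K` (extended by zero) with `f(hk) = Ψ(h) f(k)`. -/
def IndSp (S : USetting E) (H : Set (Mat E)) (Ψ : Mat E → ℂ) : Submodule ℂ (Mat E → ℂ) where
  carrier := {f | (∀ x, x ∉ Kset S → f x = 0) ∧
    ∀ h ∈ H, ∀ k ∈ Kset S, f (h * k) = Ψ h * f k}
  add_mem' := by
    rintro f g ⟨hf0, hf1⟩ ⟨hg0, hg1⟩
    refine ⟨fun x hx => ?_, fun h hh k hk => ?_⟩
    · simp [hf0 x hx, hg0 x hx]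
    · simp only [Pi.add_apply, hf1 h hh k hk, hg1 h hh k hk]; ring
  zero_mem' := ⟨fun x _ => rfl, fun h _ k _ => by simp⟩
  smul_mem' := by
    rintro c f ⟨hf0, hf1⟩
    refine ⟨fun x hx => ?_, fun h hh k hk => ?_⟩
    · simp [hf0 x hx]
    · simp only [Pi.smul_apply, hf1 h hh k hk, smul_eq_mul]; ring

/-- The functions constant on `K` and zero off `K`. -/
def ConstSub (S : USetting E) : Submodule ℂ (Mat E → ℂ) where
  carrier := {f | (∀ x, x ∉ Kset S → f x = 0) ∧ ∃ c : ℂ, ∀ k ∈ Kset S, f k = c}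
  add_mem' := by
    rintro f g ⟨hf0, c, hc⟩ ⟨hg0, c', hc'⟩
    exact ⟨fun x hx => by simp [hf0 x hx, hg0 x hx],
      c + c', fun k hk => by simp [hc k hk, hc' k hk]⟩
  zero_mem' := ⟨fun x _ => rfl, 0, fun _ _ => rfl⟩
  smul_mem' := by
    rintro a f ⟨hf0, c, hc⟩
    exact ⟨fun x hx => by simp [hf0 x hx], a * c, fun k hk => by simp [hc k hk]⟩

/-- A subspace is `K`-invariant. -/
def KInvariant (S : USetting E) (W : Submodule ℂ (Mat E → ℂ)) : Prop :=
  ∀ g ∈ Kset S, ∀ f ∈ W, rho g f ∈ W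

/-- A subset `A ⊆ K` acts trivially on `W`. -/
def ActsTrivially (S : USetting E) (A : Set (Mat E)) (W : Submodule ℂ (Mat E → ℂ)) : Prop :=
  ∀ g ∈ A, ∀ f ∈ W, rho g f = f

/-- `W` is an irreducible representation of `K`. -/
def IsIrredRep (S : USetting E) (W : Submodule ℂ (Mat E → ℂ)) : Prop :=
  W ≠ ⊥ ∧ KInvariant S W ∧
    ∀ U : Submodule ℂ (Mat E → ℂ), U ≤ W → KInvariant S U → U = ⊥ ∨ U = W

/-- `V` and `W` are isomorphic as representations of `K`. -/
def RepIso (S : USetting E) (V W : Submodule ℂ (Mat E → ℂ)) : Prop :=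
  ∃ e : (Mat E → ℂ) →ₗ[ℂ] (Mat E → ℂ), Set.BijOn ⇑e ↑V ↑W ∧
    ∀ g ∈ Kset S, ∀ f ∈ V, e (rho g f) = rho g (e f)

/-- The space of `ℂ`-linear endomorphisms of `V` commuting with the right-translation
action of `K`, realized inside the function space `↥V → ↥V`. -/
def Commutant (S : USetting E) (V : Submodule ℂ (Mat E → ℂ)) :
    Submodule ℂ (↥V → ↥V) where
  carrier := {T | (∀ x y : ↥V, T (x + y) = T x + T y) ∧
    (∀ (c : ℂ) (x : ↥V), T (c • x) = c • T x) ∧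
    ∀ g ∈ Kset S, ∀ f : ↥V, ∀ h : rho g (f : Mat E → ℂ) ∈ V,
      ((T ⟨rho g (f : Mat E → ℂ), h⟩ : ↥V) : Mat E → ℂ) = rho g ((T f : ↥V) : Mat E → ℂ)}
  add_mem' := by
    rintro T T' ⟨hT1, hT2, hT3⟩ ⟨hT1', hT2', hT3'⟩
    refine ⟨fun x y => ?_, fun c x => ?_, fun g hg f h => ?_⟩
    · simp only [Pi.add_apply, hT1 x y, hT1' x y]; abel
    · simp only [Pi.add_apply, hT2 c x, hT2' c x, smul_add]
    · simp only [Pi.add_apply, Submodule.coe_add, hT3 g hg f h, hT3' g hg f h, map_add]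
  zero_mem' := by
    refine ⟨fun x y => by simp, fun c x => by simp, fun g hg f h => by simp⟩
  smul_mem' := by
    rintro c T ⟨hT1, hT2, hT3⟩
    refine ⟨fun x y => ?_, fun a x => ?_, fun g hg f h => ?_⟩
    · simp only [Pi.smul_apply, hT1 x y, smul_add]
    · simp only [Pi.smul_apply, hT2 a x, smul_comm c a]
    · simp only [Pi.smul_apply, Submodule.coe_smul, hT3 g hg f h, _root_.map_smul]

/-- The additive character `ψ` of `E`, `ψ(x) = ψ'((x + σ(x))/2)`. -/
def psiE (S : USetting E) (x : E) : ℂ := S.psi' ((x + S.sig x) / 2)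

/-- `Ψ_Y(g) = ψ(Tr(Y (g − 1)))`. -/
def PsiC (S : USetting E) (Y g : Mat E) : ℂ := psiE S ((Y * (g - 1)).trace)

/-- The Lie algebra `𝔤 = 𝔲(1,1)(F)`. -/
def gfrak (S : USetting E) : Set (Mat E) :=
  {Y | (Y.map ⇑S.sig)ᵀ * w0 E + w0 E * Y = 0}

/-- The lattice `𝔨_s` of the Lie algebra, where `c = ⌈s⌉`. -/
def kfrakC (S : USetting E) (c : ℤ) : Set (Mat E) :=
  {Y | Y ∈ gfrak S ∧ (c : WithTop ℤ) ≤ S.nu (Y 0 0) ∧ (c : WithTop ℤ) ≤ S.nu (Y 1 1) ∧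
    (∃ t, S.sig t = t ∧ (c : WithTop ℤ) ≤ S.nu t ∧ Y 0 1 = S.sqeps * t) ∧
    (∃ t, S.sig t = t ∧ (c : WithTop ℤ) ≤ S.nu t ∧ Y 1 0 = S.sqeps * t)}

/-- The group `J_d`. -/
def Jgrp (S : USetting E) (d : ℕ) : Set (Mat E) :=
  {g | g ∈ Kset S ∧ ((((d + 1) / 2 : ℕ) : WithTop ℤ) ≤ S.nu (g 0 0 - 1)) ∧
    ((((d + 1) / 2 : ℕ) : WithTop ℤ) ≤ S.nu (g 0 1)) ∧
    ((((d + 1) / 2 : ℕ) : WithTop ℤ) ≤ S.nu (g 1 1 - 1)) ∧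
    (((d / 2 + 1 : ℕ) : WithTop ℤ) ≤ S.nu (g 1 0))}

/-- The centralizer `T(X)` in `K` of `X = [[z√ε, u√ε],[v√ε, z√ε]]`. -/
def TXset (S : USetting E) (u v : E) : Set (Mat E) :=
  {m | m ∈ Kset S ∧ m 1 1 = m 0 0 ∧ m 1 0 = m 0 1 * (u⁻¹ * v)}

/-- The center `Z` of `G`, identified with scalar matrices with entries in `E^1`. -/
def Zset (S : USetting E) : Set (Mat E) := {m | ∃ z ∈ E1set S, m = z • (1 : Mat E)}

/-- `𝒰 = U ∩ K`. -/
def Uset (S : USetting E) : Set (Mat E) :=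
  {m | ∃ b, S.sig b = b ∧ 0 ≤ S.nu b ∧ m = !![1, b * S.sqeps; 0, 1]}

/-- The set of products `T(X)·J_d`. -/
def TXJ (S : USetting E) (u v : E) (d : ℕ) : Set (Mat E) :=
  {x | ∃ t ∈ TXset S u v, ∃ j ∈ Jgrp S d, x = t * j}

/-- The set of products `Z·𝒰·J_d`. -/
def ZUJ (S : USetting E) (d : ℕ) : Set (Mat E) :=
  {x | ∃ z ∈ Zset S, ∃ m ∈ Uset S, ∃ j ∈ Jgrp S d, x = z * m * j}

/-- `X = [[z√ε, u√ε],[v√ε, z√ε]]`. -/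
def Xzuv (S : USetting E) (z u v : E) : Mat E :=
  !![z * S.sqeps, u * S.sqeps; v * S.sqeps, z * S.sqeps]

/-- The nilpotent element `X_δ = [[0, δ√ε],[0,0]]`. -/
def Xdelta (S : USetting E) (δ : E) : Mat E := !![0, δ * S.sqeps; 0, 0]

/-- `W` is a `K`-invariant complement of `V_χ^{K_d}` inside `V_χ^{K_{d+1}}`. -/
def Wcompl (S : USetting E) (χ : E → ℂ) (d : ℕ) (W : Submodule ℂ (Mat E → ℂ)) : Prop :=
  W ≤ Vsp S χ ((d : ℤ) + 1) ∧ KInvariant S W ∧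
    Vsp S χ (d : ℤ) ⊓ W = ⊥ ∧ Vsp S χ (d : ℤ) ⊔ W = Vsp S χ ((d : ℤ) + 1)

namespace USetting

/-- The valuation `nu` as a bundled additive valuation. -/
def val (S : USetting E) : AddValuation E (WithTop ℤ) :=
  AddValuation.of S.nu ((S.nu_eq_top 0).2 rfl)
    (by
      have hone := S.nu_mul 1 1
      rw [mul_one] at hone
      have hne : S.nu 1 ≠ ⊤ := fun h => one_ne_zero ((S.nu_eq_top 1).1 h)
      lift S.nu 1 to ℤ using hne with n
      norm_cast at hone ⊢
      omega)
    S.nu_add S.nu_mul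

lemma nu_eq_val (S : USetting E) (x : E) : S.nu x = S.val x := rfl

lemma val_eq_top (S : USetting E) {x : E} : S.val x = ⊤ ↔ x = 0 := S.nu_eq_top x

lemma val_sig (S : USetting E) (x : E) : S.val (S.sig x) = S.val x := S.nu_sig x

lemma ne_zero_of_val_eq_zero (S : USetting E) {x : E} (hx : S.val x = 0) : x ≠ 0 := by
  rintro rfl
  simp at hx

lemma val_inv_eq_zero (S : USetting E) {x : E} (hx : S.val x = 0) : S.val x⁻¹ = 0 := by
  rw [AddValuation.map_inv, hx, neg_zero]

lemma val_div_unit (S : USetting E) (x : E) {y : E} (hy : S.val y = 0) :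
    S.val (x / y) = S.val x := by
  rw [div_eq_mul_inv, AddValuation.map_mul, S.val_inv_eq_zero hy, add_zero]

lemma val_mul_nonneg (S : USetting E) {x y : E} (hx : 0 ≤ S.val x) (hy : 0 ≤ S.val y) :
    0 ≤ S.val (x * y) := by
  rw [AddValuation.map_mul]
  exact add_nonneg hx hy

lemma val_eq_zero_of_mul (S : USetting E) {x y : E} (hx : 0 ≤ S.val x) (hy : 0 ≤ S.val y)
    (hxy : S.val (x * y) = 0) : S.val x = 0 ∧ S.val y = 0 := by
  rw [AddValuation.map_mul] at hxy
  exact (add_eq_zero_iff_of_nonneg hx hy).1 hxy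

lemma one_le_iff_pos {n : WithTop ℤ} : 1 ≤ n ↔ 0 < n := by
  induction n using WithTop.recTopCoe with
  | top => simp
  | coe n => norm_cast

lemma eq_zero_or_one_le {n : WithTop ℤ} (hn : 0 ≤ n) : n = 0 ∨ 1 ≤ n := by
  rw [one_le_iff_pos]
  exact hn.eq_or_lt.imp_left Eq.symm

lemma val_pi_pow (S : USetting E) (j : ℕ) : S.val (S.pi ^ j) = ((j : ℤ) : WithTop ℤ) := by
  rw [AddValuation.map_pow, ← nu_eq_val, S.nu_pi, nsmul_one]
  rfl

lemma eq_zero_of_forall_le_val (S : USetting E) {x : E}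
    (hx : ∀ n : ℕ, ((n : ℤ) : WithTop ℤ) ≤ S.val x) : x = 0 := by
  by_contra hne
  have htop : S.val x ≠ ⊤ := fun h => hne (S.val_eq_top.1 h)
  lift S.val x to ℤ using htop with m
  have h := hx (m.toNat + 1)
  norm_cast at h
  omega

/-- The ring of integers of the fixed field of `sig`. -/
def fixedIntegers (S : USetting E) : Subring E where
  carrier := {x | S.sig x = x ∧ 0 ≤ S.val x}
  mul_mem' := fun hx hy => ⟨by rw [map_mul, hx.1, hy.1], S.val_mul_nonneg hx.2 hy.2⟩
  one_mem' := ⟨map_one _, by simp⟩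
  add_mem' := fun hx hy => ⟨by rw [map_add, hx.1, hy.1], S.val.map_le_add hx.2 hy.2⟩
  zero_mem' := ⟨map_zero _, by simp⟩
  neg_mem' := fun hx => ⟨by rw [map_neg, hx.1], by rw [AddValuation.map_neg]; exact hx.2⟩

/-- The maximal ideal of the ring of integers of the fixed field of `sig`. -/
def fixedMaximalIdeal (S : USetting E) : Ideal S.fixedIntegers where
  carrier := {x | 1 ≤ S.val x}
  add_mem' := fun hx hy => S.val.map_le_add hx hy
  zero_mem' := by simp
  smul_mem' := fun c x hx => by
    simp only [Set.mem_ofPred_eq, smul_eq_mul, Subring.coe_mul, AddValuation.map_mul] at hx ⊢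
    simpa using add_le_add c.2.2 hx

lemma mem_fixedMaximalIdeal (S : USetting E) {x : S.fixedIntegers} :
    x ∈ S.fixedMaximalIdeal ↔ 1 ≤ S.val (x : E) := Iff.rfl

instance fixedMaximalIdeal_isPrime (S : USetting E) : S.fixedMaximalIdeal.IsPrime := by
  refine Ideal.isPrime_iff.2 ⟨fun h => ?_, fun {x y} h => ?_⟩
  · have h1 := (Ideal.eq_top_iff_one _).1 h
    rw [mem_fixedMaximalIdeal] at h1
    simp only [Subring.coe_one, AddValuation.map_one] at h1
    exact absurd h1 (by decide)
  · rw [mem_fixedMaximalIdeal, mem_fixedMaximalIdeal]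
    rw [mem_fixedMaximalIdeal, Subring.coe_mul, AddValuation.map_mul] at h
    rcases eq_zero_or_one_le x.2.2 with hx | hx
    · right
      rwa [hx, zero_add] at h
    · exact Or.inl hx

instance residueField_finite (S : USetting E) :
    Finite (S.fixedIntegers ⧸ S.fixedMaximalIdeal) := by
  obtain ⟨R, -, hR, hex⟩ := S.res_card
  refine Finite.of_surjective
    (fun x : R => Ideal.Quotient.mk S.fixedMaximalIdeal ⟨x, hR x x.2⟩) fun y => ?_
  obtain ⟨y, rfl⟩ := Ideal.Quotient.mk_surjective y
  obtain ⟨x, ⟨hxR, hx⟩, -⟩ := hex y y.2.1 y.2.2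
  refine ⟨⟨x, hxR⟩, ?_⟩
  rw [eq_comm, Ideal.Quotient.eq]
  exact hx

lemma residueField_two_ne_zero (S : USetting E) :
    (2 : S.fixedIntegers ⧸ S.fixedMaximalIdeal) ≠ 0 := by
  intro h
  have h2 : (2 : S.fixedIntegers) ∈ S.fixedMaximalIdeal :=
    Ideal.Quotient.eq_zero_iff_mem.1 h
  have h3 : 1 ≤ S.nu 2 := h2
  rw [S.nu_two] at h3
  exact absurd h3 (by decide)

end USetting

lemma card_odd_of_two_ne_zero (R : Type*) [CommRing R] [IsDomain R] [Fintype R]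
    (h2 : (2 : R) ≠ 0) : Fintype.card R % 2 = 1 := by
  by_contra hodd
  have hdvd : 2 ∣ Fintype.card R := by omega
  have : Fact (Nat.Prime 2) := ⟨Nat.prime_two⟩
  obtain ⟨x, hx⟩ := exists_prime_addOrderOf_dvd_card 2 hdvd
  have hx2 : 2 • x = 0 := hx ▸ addOrderOf_nsmul_eq_zero x
  rw [two_nsmul, ← two_mul] at hx2
  rcases mul_eq_zero.1 hx2 with h | h
  · exact h2 h
  · simp [h] at hx

lemma exists_sq_sub_mul_sq (R : Type*) [CommRing R] [IsDomain R] [Finite R]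
    (h2 : (2 : R) ≠ 0) {e : R} (he : e ≠ 0) (u : R) : ∃ x y : R, x ^ 2 - e * y ^ 2 = u := by
  have := Fintype.ofFinite R
  obtain ⟨x, y, h⟩ := FiniteField.exists_root_sum_quadratic
    (f := Polynomial.X ^ 2 - Polynomial.C u) (g := Polynomial.C (-e) * Polynomial.X ^ 2)
    (Polynomial.degree_X_pow_sub_C (by norm_num) u)
    (Polynomial.degree_C_mul_X_pow 2 (neg_ne_zero.2 he)) (card_odd_of_two_ne_zero R h2)
  refine ⟨x, y, ?_⟩
  simp only [Polynomial.eval_sub, Polynomial.eval_mul, Polynomial.eval_pow, Polynomial.eval_X,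
    Polynomial.eval_C] at h
  linear_combination h

namespace USetting

/-- Hensel's lemma for square roots: a fixed element that is congruent to the square of a fixed
unit is the square of a fixed element. -/
lemma exists_sq_eq (S : USetting E) {v z : E} (hv : S.sig v = v) (hz : S.sig z = z)
    (hz0 : S.val z = 0) (hzv : 1 ≤ S.val (z ^ 2 - v)) : ∃ L, S.sig L = L ∧ L ^ 2 = v := by
  have h2 : S.val 2 = 0 := S.nu_two
  have h20 : (2 : E) ≠ 0 := S.ne_zero_of_val_eq_zero h2
  have hzne : z ≠ 0 := S.ne_zero_of_val_eq_zero hz0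
  have h2z : S.val (2 * z) = 0 := by rw [AddValuation.map_mul, h2, hz0, add_zero]
  let f : ℕ → E := fun n => Nat.rec z (fun _ x => x - (x ^ 2 - v) / (2 * z)) n
  have hf (n : ℕ) : f (n + 1) = f n - (f n ^ 2 - v) / (2 * z) := rfl
  have key (n : ℕ) : S.sig (f n) = f n ∧ 1 ≤ S.val (f n - z) ∧
      (((n + 1 : ℕ) : ℤ) : WithTop ℤ) ≤ S.val (f n ^ 2 - v) := by
    induction n with
    | zero => exact ⟨hz, by simp [f], by simpa [f] using hzv⟩
    | succ n ih =>
      obtain ⟨h1, h3, h4⟩ := ih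
      have h5 : 1 ≤ S.val (f n ^ 2 - v) := le_trans (by norm_cast; omega) h4
      have h6 : f (n + 1) ^ 2 - v = (f n ^ 2 - v) *
          (((f n ^ 2 - v) / (2 * z)) / (2 * z) - (f n - z) / z) := by
        rw [hf]
        field_simp
        ring
      refine ⟨?_, ?_, ?_⟩
      · rw [hf]
        simp [h1, hv, hz, map_ofNat]
      · rw [hf, sub_right_comm]
        exact S.val.map_le_sub h3 (by rwa [S.val_div_unit _ h2z])
      · rw [h6, AddValuation.map_mul]
        have h7 : 1 ≤ S.val (((f n ^ 2 - v) / (2 * z)) / (2 * z) - (f n - z) / z) :=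
          S.val.map_le_sub (by rwa [S.val_div_unit _ h2z, S.val_div_unit _ h2z])
            (by rwa [S.val_div_unit _ hz0])
        refine le_trans (le_of_eq ?_) (add_le_add h4 h7)
        norm_cast
  obtain ⟨L, hL⟩ := S.complete f fun n => by
    have h : S.nu (f (n + 1) - f n) = S.val (f n ^ 2 - v) := by
      rw [nu_eq_val, hf, sub_sub_cancel_left, AddValuation.map_neg, S.val_div_unit _ h2z]
    rw [h]
    exact le_trans (by norm_cast; omega) (key n).2.2
  refine ⟨L, ?_, ?_⟩
  · refine sub_eq_zero.1 (S.eq_zero_of_forall_le_val fun n => ?_)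
    have h : S.sig L - L = S.sig (L - f n) - (L - f n) := by
      rw [map_sub, (key n).1]
      ring
    rw [h]
    exact S.val.map_le_sub (by rw [S.val_sig]; exact hL n) (hL n)
  · refine sub_eq_zero.1 (S.eq_zero_of_forall_le_val fun n => ?_)
    have h : L ^ 2 - v = (L - f n) * (L - f n + 2 * (f n - z) + 2 * z) + (f n ^ 2 - v) := by
      ring
    rw [h]
    refine S.val.map_le_add ?_ (le_trans (by norm_cast; omega) (key n).2.2)
    rw [AddValuation.map_mul]
    have h8 : 0 ≤ S.val (L - f n + 2 * (f n - z) + 2 * z) := by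
      refine S.val.map_le_add (S.val.map_le_add (le_trans (by norm_cast; omega) (hL n)) ?_) h2z.ge
      rw [AddValuation.map_mul, h2, zero_add]
      exact le_trans (by decide) (key n).2.1
    have hLn : ((n : ℤ) : WithTop ℤ) ≤ S.val (L - f n) := hL n
    simpa using add_le_add hLn h8

/-- Every unit of the fixed field of `sig` is the norm of a unit. -/
lemma exists_norm_eq (S : USetting E) {u : E} (hu : S.sig u = u) (hu0 : S.val u = 0) :
    ∃ α, S.val α = 0 ∧ α * S.sig α = u := by
  have hs0 : S.val S.sqeps = 0 := S.nu_sqeps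
  have hsne : S.sqeps ≠ 0 := S.ne_zero_of_val_eq_zero hs0
  have he0 : S.val (S.sqeps ^ 2) = 0 := by rw [AddValuation.map_pow, hs0, smul_zero]
  have he : S.sig (S.sqeps ^ 2) = S.sqeps ^ 2 := by rw [map_pow, S.sig_sqeps, neg_sq]
  suffices h : ∃ x y, S.sig x = x ∧ S.sig y = y ∧ x ^ 2 - S.sqeps ^ 2 * y ^ 2 = u by
    obtain ⟨x, y, hx, hy, hxy⟩ := h
    have hnorm : (x + y * S.sqeps) * S.sig (x + y * S.sqeps) = u := by
      rw [map_add, map_mul, hx, hy, S.sig_sqeps, ← hxy]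
      ring
    refine ⟨x + y * S.sqeps, ?_, hnorm⟩
    have hval := congrArg S.val hnorm
    rw [AddValuation.map_mul, S.val_sig, hu0] at hval
    generalize S.val (x + y * S.sqeps) = n at hval
    induction n using WithTop.recTopCoe with
    | top => simp at hval
    | coe n =>
      norm_cast at hval ⊢
      omega
  obtain ⟨x, y, hxy⟩ := exists_sq_sub_mul_sq (S.fixedIntegers ⧸ S.fixedMaximalIdeal)
    S.residueField_two_ne_zero
    (e := Ideal.Quotient.mk _ ⟨S.sqeps ^ 2, he, he0.ge⟩)
    (fun h => by
      rw [Ideal.Quotient.eq_zero_iff_mem, mem_fixedMaximalIdeal, he0] at h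
      exact absurd h (by decide))
    (Ideal.Quotient.mk _ ⟨u, hu, hu0.ge⟩)
  obtain ⟨⟨x, hx, hx0⟩, rfl⟩ := Ideal.Quotient.mk_surjective x
  obtain ⟨⟨y, hy, hy0⟩, rfl⟩ := Ideal.Quotient.mk_surjective y
  rw [← map_pow, ← map_pow, ← map_mul, ← map_sub, Ideal.Quotient.eq] at hxy
  replace hxy : 1 ≤ S.val (x ^ 2 - S.sqeps ^ 2 * y ^ 2 - u) := hxy
  rcases eq_zero_or_one_le hx0 with hxu | hxp
  · obtain ⟨L, hL, hL2⟩ := S.exists_sq_eq (v := u + S.sqeps ^ 2 * y ^ 2) (z := x)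
      (by rw [map_add, map_mul, map_pow S.sig y, hu, he, hy]) hx hxu
      (by convert hxy using 2; ring)
    exact ⟨L, y, hL, hy, by rw [hL2]; ring⟩
  · have hx2 : 1 ≤ S.val (x ^ 2) := by
      rw [pow_two, AddValuation.map_mul]
      simpa using add_le_add hx0 hxp
    have hyu : S.val y = 0 := by
      refine (eq_zero_or_one_le hy0).resolve_right fun hyp => ?_
      have hy2 : 1 ≤ S.val (S.sqeps ^ 2 * y ^ 2) := by
        rw [AddValuation.map_mul, he0, zero_add, pow_two, AddValuation.map_mul]
        simpa using add_le_add hy0 hyp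
      have h := S.val.map_le_sub (S.val.map_le_sub hx2 hy2) hxy
      rw [sub_sub_cancel, hu0] at h
      exact absurd h (by decide)
    obtain ⟨L, hL, hL2⟩ := S.exists_sq_eq (v := (x ^ 2 - u) / S.sqeps ^ 2) (z := y)
      (by rw [map_div₀, map_sub, map_pow S.sig x, hu, he, hx]) hy hyu
      (by
        have h : y ^ 2 - (x ^ 2 - u) / S.sqeps ^ 2 =
            -(x ^ 2 - S.sqeps ^ 2 * y ^ 2 - u) / S.sqeps ^ 2 := by
          field_simp
          ring
        rw [h, S.val_div_unit _ he0, AddValuation.map_neg]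
        exact hxy)
    exact ⟨x, L, hx, hL, by rw [hL2]; field_simp; ring⟩

end USetting

lemma mem_Gset_iff (S : USetting E) (a b c d : E) :
    !![a, b; c, d] ∈ Gset S ↔
      S.sig c * a + S.sig a * c = 0 ∧ S.sig c * b + S.sig a * d = 1 ∧
      S.sig d * a + S.sig b * c = 1 ∧ S.sig d * b + S.sig b * d = 0 := by
  simp only [Gset, w0, Set.mem_ofPred_eq]
  rw [← Matrix.ext_iff]
  simp [Fin.forall_fin_two, Matrix.mul_apply, Fin.sum_univ_two, and_assoc]

lemma mem_Kset_iff (S : USetting E) (a b c d : E) :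
    !![a, b; c, d] ∈ Kset S ↔ !![a, b; c, d] ∈ Gset S ∧
      (0 ≤ S.val a ∧ 0 ≤ S.val b ∧ 0 ≤ S.val c ∧ 0 ≤ S.val d) ∧ S.val (a * d - b * c) = 0 := by
  rw [Kset, Set.mem_ofPred_eq]
  simp [Fin.forall_fin_two, Matrix.det_fin_two, USetting.nu_eq_val, and_assoc]

/-- The right factor of an element of `K` lies in `K` if the left one does and its entries
are integral. -/
lemma mem_Kset_of_mul_mem (S : USetting E) {A B : Mat E} (hA : A ∈ Kset S)
    (hAB : A * B ∈ Kset S) (hB : ∀ i j, 0 ≤ S.val (B i j)) : B ∈ Kset S := by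
  refine ⟨?_, hB, ?_⟩
  · have h1 : (A.map S.sig)ᵀ * w0 E * A = w0 E := hA.1
    have h2 : ((A * B).map S.sig)ᵀ * w0 E * (A * B) = w0 E := hAB.1
    change (B.map S.sig)ᵀ * w0 E * B = w0 E
    rw [Matrix.map_mul, Matrix.transpose_mul] at h2
    calc (B.map S.sig)ᵀ * w0 E * B
        = (B.map S.sig)ᵀ * ((A.map S.sig)ᵀ * w0 E * A) * B := by rw [h1]
      _ = (B.map S.sig)ᵀ * (A.map S.sig)ᵀ * w0 E * (A * B) := by simp only [Matrix.mul_assoc]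
      _ = w0 E := h2
  · have h := hAB.2.2
    rwa [Matrix.det_mul, S.nu_mul, hA.2.2, zero_add] at h

lemma mul_mem_Kset (S : USetting E) {A B : Mat E} (hA : A ∈ Kset S) (hB : B ∈ Kset S) :
    A * B ∈ Kset S := by
  refine ⟨?_, fun i j => ?_, ?_⟩
  · have h1 : (A.map S.sig)ᵀ * w0 E * A = w0 E := hA.1
    have h2 : (B.map S.sig)ᵀ * w0 E * B = w0 E := hB.1
    change ((A * B).map S.sig)ᵀ * w0 E * (A * B) = w0 E
    rw [Matrix.map_mul, Matrix.transpose_mul]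
    calc (B.map S.sig)ᵀ * (A.map S.sig)ᵀ * w0 E * (A * B)
        = (B.map S.sig)ᵀ * ((A.map S.sig)ᵀ * w0 E * A) * B := by simp only [Matrix.mul_assoc]
      _ = w0 E := by rw [h1, h2]
  · rw [Matrix.mul_apply]
    exact S.val.map_le_sum fun l _ => S.val_mul_nonneg (hA.2.1 i l) (hB.2.1 l j)
  · rw [Matrix.det_mul, S.nu_mul, hA.2.2, hB.2.2, add_zero]

lemma one_mem_Bcal (S : USetting E) : (1 : Mat E) ∈ Bcal S := by
  refine ⟨?_, by simp⟩
  rw [Matrix.one_fin_two, mem_Kset_iff, mem_Gset_iff]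
  simp

lemma w0_mem_Kset (S : USetting E) : w0 E ∈ Kset S := by
  rw [w0, mem_Kset_iff, mem_Gset_iff]
  simp

lemma unipotent_mem_Bcal (S : USetting E) {x : E} (hx : S.sig x + x = 0) (hx0 : 0 ≤ S.val x) :
    !![1, x; 0, 1] ∈ Bcal S := by
  refine ⟨?_, by simp⟩
  rw [mem_Kset_iff, mem_Gset_iff]
  simp [hx0, add_comm x, hx]

lemma lower_unipotent_mem_Kset (S : USetting E) {x : E} (hx : S.sig x + x = 0)
    (hx0 : 0 ≤ S.val x) : !![1, 0; x, 1] ∈ Kset S := by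
  rw [mem_Kset_iff, mem_Gset_iff]
  simp [hx0, hx]

lemma diagonal_mem_Bcal (S : USetting E) {α : E} (hα : S.val α = 0) :
    !![α, 0; 0, (S.sig α)⁻¹] ∈ Bcal S := by
  have hne : α ≠ 0 := S.ne_zero_of_val_eq_zero hα
  have hσ : S.val (S.sig α)⁻¹ = 0 := S.val_inv_eq_zero (by rw [S.val_sig, hα])
  refine ⟨?_, by simp⟩
  rw [mem_Kset_iff, mem_Gset_iff]
  simp [hα, hσ, hne, S.sig_invol]

/-- The valuation of the lower left entry is constant on double cosets of `𝓑`. -/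
lemma val_lower_left_of_mem_Bcal (S : USetting E) {b₁ b₂ : Mat E} (h₁ : b₁ ∈ Bcal S)
    (h₂ : b₂ ∈ Bcal S) (g : Mat E) : S.val ((b₁ * g * b₂) 1 0) = S.val (g 1 0) := by
  have hdiag {b : Mat E} (hb : b ∈ Bcal S) : S.val (b 0 0) = 0 ∧ S.val (b 1 1) = 0 := by
    refine S.val_eq_zero_of_mul (hb.1.2.1 0 0) (hb.1.2.1 1 1) ?_
    have h := hb.1.2.2
    rwa [Matrix.det_fin_two, hb.2, mul_zero, sub_zero] at h
  have hentry : (b₁ * g * b₂) 1 0 = b₁ 1 1 * g 1 0 * b₂ 0 0 := by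
    simp [Matrix.mul_apply, Fin.sum_univ_two, h₁.2, h₂.2]
  rw [hentry, AddValuation.map_mul, AddValuation.map_mul, (hdiag h₁).2, (hdiag h₂).1, zero_add,
    add_zero]

lemma val_lower_left_rep (S : USetting E) (j : ℕ) :
    S.val (S.sqeps * S.pi ^ j) = ((j : ℤ) : WithTop ℤ) := by
  have hs0 : S.val S.sqeps = 0 := S.nu_sqeps
  rw [AddValuation.map_mul, hs0, zero_add, S.val_pi_pow]

/-- The listed representatives are determined by the valuation of their lower left entry. -/
lemma rep_eq_of_val_eq (S : USetting E) {g h : Mat E}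
    (hg : g = 1 ∨ g = w0 E ∨ ∃ j : ℕ, 1 ≤ j ∧ g = !![1, 0; S.sqeps * S.pi ^ j, 1])
    (hh : h = 1 ∨ h = w0 E ∨ ∃ j : ℕ, 1 ≤ j ∧ h = !![1, 0; S.sqeps * S.pi ^ j, 1])
    (hval : S.val (g 1 0) = S.val (h 1 0)) : g = h := by
  have htop (j : ℕ) : ((j : ℤ) : WithTop ℤ) ≠ ⊤ := WithTop.coe_ne_top
  have hzero {j : ℕ} (hj : 1 ≤ j) : ((j : ℤ) : WithTop ℤ) ≠ 0 := by
    norm_cast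
    omega
  rcases hg with rfl | rfl | ⟨i, hi, rfl⟩ <;> rcases hh with rfl | rfl | ⟨j, hj, rfl⟩
  · rfl
  · simp [w0] at hval
  · simp only [one_apply_ne (one_ne_zero : (1 : Fin 2) ≠ 0), AddValuation.map_zero, of_apply,
      cons_val_zero, cons_val_one, val_lower_left_rep] at hval
    exact absurd hval.symm (htop j)
  · simp [w0] at hval
  · rfl
  · simp only [w0, AddValuation.map_one, of_apply, cons_val_zero, cons_val_one,
      val_lower_left_rep] at hval
    exact absurd hval.symm (hzero hj)
  · simp only [one_apply_ne (one_ne_zero : (1 : Fin 2) ≠ 0), AddValuation.map_zero, of_apply,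
      cons_val_zero, cons_val_one, val_lower_left_rep] at hval
    exact absurd hval (htop i)
  · simp only [w0, AddValuation.map_one, of_apply, cons_val_zero, cons_val_one,
      val_lower_left_rep] at hval
    exact absurd hval (hzero hi)
  · simp only [of_apply, cons_val_zero, cons_val_one, val_lower_left_rep] at hval
    norm_cast at hval
    rw [hval]

/-- An element of `K` whose lower left entry is a unit lies in the double coset of `w₀`. -/
lemma exists_decomp_w0 (S : USetting E) {a b c d : E} (hk : !![a, b; c, d] ∈ Kset S)
    (hc : S.val c = 0) :
    ∃ b₁ ∈ Bcal S, ∃ b₂ ∈ Bcal S, !![a, b; c, d] = b₁ * w0 E * b₂ := by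
  have hk' := hk
  rw [mem_Kset_iff, mem_Gset_iff] at hk'
  obtain ⟨⟨h00, -, -, -⟩, ⟨ha0, hb0, hc0, hd0⟩, hdet⟩ := hk'
  have hcne : c ≠ 0 := S.ne_zero_of_val_eq_zero hc
  have hσc : S.sig c ≠ 0 := (map_ne_zero S.sig).2 hcne
  have hb₁ : !![1, a / c; 0, 1] ∈ Bcal S := by
    refine unipotent_mem_Bcal S ?_ (by rwa [S.val_div_unit _ hc])
    rw [map_div₀]
    field_simp
    linear_combination h00
  have hprod : !![a, b; c, d] = !![1, a / c; 0, 1] * w0 E * !![c, d; 0, b - a * d / c] := by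
    ext i j
    fin_cases i <;> fin_cases j <;>
      simp [w0, Matrix.mul_apply, Fin.sum_univ_two, hcne]
    field_simp
    ring
  refine ⟨_, hb₁, _, ⟨?_, by simp⟩, hprod⟩
  refine mem_Kset_of_mul_mem S (mul_mem_Kset S hb₁.1 (w0_mem_Kset S)) (hprod ▸ hk) ?_
  have he : 0 ≤ S.val (b - a * d / c) :=
    S.val.map_le_sub hb0 (by rw [S.val_div_unit _ hc]; exact S.val_mul_nonneg ha0 hd0)
  simp [Fin.forall_fin_two, hc0, hd0, he]

/-- An element of `K` whose lower left entry has valuation `j ≥ 1` lies in the double coset of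
the lower triangular representative of level `j`. -/
lemma exists_decomp_lower (S : USetting E) {a b c d : E} (hk : !![a, b; c, d] ∈ Kset S) {j : ℕ}
    (hj : 1 ≤ j) (hc : S.val c = ((j : ℤ) : WithTop ℤ)) :
    ∃ b₁ ∈ Bcal S, ∃ b₂ ∈ Bcal S,
      !![a, b; c, d] = b₁ * !![1, 0; S.sqeps * S.pi ^ j, 1] * b₂ := by
  have hk' := hk
  rw [mem_Kset_iff, mem_Gset_iff] at hk'
  obtain ⟨⟨h00, -, -, -⟩, ⟨ha0, hb0, hc0, hd0⟩, hdet⟩ := hk'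
  have hsval := val_lower_left_rep S j
  have hσs : S.sig (S.sqeps * S.pi ^ j) = -(S.sqeps * S.pi ^ j) := by
    rw [map_mul, map_pow, S.sig_sqeps, S.sig_pi, neg_mul]
  generalize hs : S.sqeps * S.pi ^ j = s at hsval hσs
  have hs0 : 0 ≤ S.val s := by
    rw [hsval]
    norm_cast
    omega
  have hsne : s ≠ 0 := by
    rintro rfl
    simp at hsval
  have hcne : c ≠ 0 := by
    rintro rfl
    simp at hc
  have hσc : S.sig c ≠ 0 := (map_ne_zero S.sig).2 hcne
  have ha : S.val a = 0 := by
    refine (USetting.eq_zero_or_one_le ha0).resolve_right fun hap => ?_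
    have h1 : 1 ≤ S.val (a * d) := by
      rw [AddValuation.map_mul]
      simpa using add_le_add hap hd0
    have h2 : 1 ≤ S.val (b * c) := by
      rw [AddValuation.map_mul, hc]
      have hj' : (1 : WithTop ℤ) ≤ ((j : ℤ) : WithTop ℤ) := by exact_mod_cast hj
      simpa using add_le_add hb0 hj'
    have h := S.val.map_le_sub h1 h2
    rw [hdet] at h
    exact absurd h (by decide)
  obtain ⟨α, hα, hnorm⟩ := S.exists_norm_eq (u := s * a / c)
    (by
      rw [map_div₀, map_mul, hσs]
      field_simp
      linear_combination -h00)
    (by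
      rw [AddValuation.map_div, AddValuation.map_mul, hsval, ha, hc, add_zero]
      norm_cast
      simp)
  have hαne : α ≠ 0 := S.ne_zero_of_val_eq_zero hα
  have hσα : S.sig α ≠ 0 := (map_ne_zero S.sig).2 hαne
  rw [eq_div_iff hcne] at hnorm
  have hb₁ := diagonal_mem_Bcal S hα
  have hprod : !![a, b; c, d] = !![α, 0; 0, (S.sig α)⁻¹] * !![1, 0; s, 1] *
      !![a / α, b / α; 0, S.sig α * d - s * (b / α)] := by
    ext i j
    fin_cases i <;> fin_cases j <;>
      simp [Matrix.mul_apply, Fin.sum_univ_two]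
    · field_simp
    · field_simp
    · field_simp
      linear_combination hnorm
    · field_simp
      ring
  refine ⟨_, hb₁, _, ⟨?_, by simp⟩, hprod⟩
  refine mem_Kset_of_mul_mem S
    (mul_mem_Kset S hb₁.1 (lower_unipotent_mem_Kset S (by rw [hσs]; ring) hs0)) (hprod ▸ hk) ?_
  have hbα : 0 ≤ S.val (b / α) := by rwa [S.val_div_unit _ hα]
  have haα : 0 ≤ S.val (a / α) := by rwa [S.val_div_unit _ hα]
  have he : 0 ≤ S.val (S.sig α * d - s * (b / α)) :=
    S.val.map_le_sub (S.val_mul_nonneg (by rw [S.val_sig, hα]) hd0) (S.val_mul_nonneg hs0 hbα)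
  simp [Fin.forall_fin_two, -AddValuation.map_div, haα, hbα, he]

/-- the matrices `1`, `w₀` and `g_j = [[1,0],[√ε ϖ^j, 1]]` (`j ≥ 1`) form a
complete set of representatives for the double cosets `𝓑\K/𝓑`: every element of `K` lies
in `𝓑·g·𝓑` for exactly one matrix `g` in this list. -/
theorem stmt1 (S : USetting E) (k : Mat E) (hk : k ∈ Kset S) :
    ∃! g : Mat E,
      (g = 1 ∨ g = w0 E ∨ ∃ j : ℕ, 1 ≤ j ∧ g = !![1, 0; S.sqeps * S.pi ^ j, 1]) ∧
      ∃ b₁ ∈ Bcal S, ∃ b₂ ∈ Bcal S, k = b₁ * g * b₂ := by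
  have hexists : ∃ g : Mat E,
      (g = 1 ∨ g = w0 E ∨ ∃ j : ℕ, 1 ≤ j ∧ g = !![1, 0; S.sqeps * S.pi ^ j, 1]) ∧
      ∃ b₁ ∈ Bcal S, ∃ b₂ ∈ Bcal S, k = b₁ * g * b₂ := by
    by_cases hc : k 1 0 = 0
    · exact ⟨1, Or.inl rfl, 1, one_mem_Bcal S, k, ⟨hk, hc⟩, by simp⟩
    have hc0 : 0 ≤ S.val (k 1 0) := hk.2.1 1 0
    obtain ⟨n, hn⟩ := WithTop.ne_top_iff_exists.1 (mt S.val_eq_top.1 hc)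
    rw [← hn] at hc0
    lift n to ℕ using by exact_mod_cast hc0
    rw [Matrix.eta_fin_two k] at hk ⊢
    rcases Nat.eq_zero_or_pos n with rfl | hpos
    · exact ⟨w0 E, Or.inr (Or.inl rfl), exists_decomp_w0 S hk hn.symm⟩
    · exact ⟨_, Or.inr (Or.inr ⟨n, hpos, rfl⟩), exists_decomp_lower S hk hpos hn.symm⟩
  obtain ⟨g, hg, b₁, h₁, b₂, h₂, hkg⟩ := hexists
  refine ⟨g, ⟨hg, b₁, h₁, b₂, h₂, hkg⟩, ?_⟩
  rintro h ⟨hh, c₁, hc₁, c₂, hc₂, hkh⟩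
  refine rep_eq_of_val_eq S hh hg ?_
  rw [← val_lower_left_of_mem_Bcal S hc₁ hc₂ h, ← val_lower_left_of_mem_Bcal S h₁ h₂ g,
    ← hkh, ← hkg]
end
end

section
/- Every group homomorphism χ : E^× → ℂ^× of true depth r ∈ ℤ_{≥0} can be written as χ(a) = φ(a·σ(a)^{-1})·χ′(a) for all a ∈ E^×, where φ : E^1 → ℂ^× is a group homomorphism and χ′ : E^× → ℂ^× is a character of minimal depth r. -/
open Matrix

noncomputable section

variable {E : Type} [Field E]

/-- A character defined on the source of a homomorphism `θ` of abelian groups and trivial on its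
kernel is the pullback along `θ` of a character of the target. -/
theorem exists_comp_eq_of_ker_le {A B : Type*} [CommGroup A] [CommGroup B] (θ : A →* B)
    (g : A →* ℂˣ) (h : θ.ker ≤ g.ker) : ∃ φ : B →* ℂˣ, ∀ a, φ (θ a) = g a := by
  have hroot : ∀ {n : ℕ}, n ≠ 0 → Function.Surjective (fun a => a ^ n : ℂˣ → ℂˣ) := by
    intro n hn u
    obtain ⟨z, hz⟩ := IsAlgClosed.exists_pow_nat_eq (u : ℂ) (Nat.pos_of_ne_zero hn)
    have hz0 : z ≠ 0 := by
      rintro rfl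
      rw [zero_pow hn] at hz
      exact u.ne_zero hz.symm
    exact ⟨Units.mk0 z hz0, Units.ext (by simpa using hz)⟩
  let : RootableBy ℂˣ ℕ := rootableByOfPowLeftSurj _ _ hroot
  let : RootableBy ℂˣ ℤ := Group.rootableByIntOfRootableByNat _
  let : DivisibleBy (Additive ℂˣ) ℤ :=
    { div := fun a n => Additive.ofMul (RootableBy.root a.toMul n)
      div_zero := fun a => congrArg Additive.ofMul (RootableBy.root_zero a.toMul)
      div_cancel := fun a hn => congrArg Additive.ofMul (RootableBy.root_cancel a.toMul hn) }
  obtain ⟨ψ, hψ⟩ := (Module.Baer.of_divisible (Additive ℂˣ)).extension_property_addMonoidHom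
    (MonoidHom.toAdditive (QuotientGroup.kerLift θ)) (QuotientGroup.kerLift_injective θ)
    (MonoidHom.toAdditive (QuotientGroup.lift θ.ker g h))
  exact ⟨MonoidHom.toAdditive.symm ψ,
    fun a => DFunLike.congr_fun hψ (Additive.ofMul (QuotientGroup.mk a))⟩

namespace USetting

theorem nu_one (S : USetting E) : S.nu 1 = 0 := by
  have h := S.nu_mul 1 1
  have htop : S.nu 1 ≠ ⊤ := fun h => one_ne_zero ((S.nu_eq_top 1).1 h)
  lift S.nu 1 to ℤ using htop with n hn
  rw [mul_one, ← hn] at h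
  norm_cast at h ⊢
  omega

theorem nu_neg (S : USetting E) (x : E) : S.nu (-x) = S.nu x := by
  have h := S.nu_mul (-1) (-1)
  have htop : S.nu (-1) ≠ ⊤ := fun h => neg_ne_zero.2 one_ne_zero ((S.nu_eq_top (-1)).1 h)
  have h1 : S.nu (-1) = 0 := by
    rw [neg_mul_neg, one_mul, S.nu_one] at h
    lift S.nu (-1) to ℤ using htop with n hn
    norm_cast at h ⊢
    omega
  rw [← neg_one_mul, S.nu_mul, h1, zero_add]

/-- Principal units have valuation zero. -/
theorem nu_eq_zero_of_pos_nu_sub_one (S : USetting E) {x : E} (hx : 0 < S.nu (x - 1)) :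
    S.nu x = 0 := by
  apply le_antisymm
  · have h := S.nu_add x (-(x - 1))
    rw [S.nu_neg, show x + -(x - 1) = 1 by ring, S.nu_one] at h
    exact (min_le_iff.1 h).resolve_right (not_le.2 hx)
  · have h := S.nu_add 1 (x - 1)
    rwa [S.nu_one, min_eq_left hx.le, add_sub_cancel] at h

theorem ne_zero_of_pos_nu_sub_one (S : USetting E) {x : E} (hx : 0 < S.nu (x - 1)) : x ≠ 0 := by
  rw [ne_eq, ← S.nu_eq_top, S.nu_eq_zero_of_pos_nu_sub_one hx]
  exact WithTop.zero_ne_top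

/-- The subgroup `1 + p_E^{r+1}` of `E^×`. -/
def principalUnits (S : USetting E) (r : ℕ) : Subgroup Eˣ where
  carrier := {u | (u : E) ∈ onePE S ((r : ℤ) + 1)}
  one_mem' := by simp [onePE, (S.nu_eq_top 0).2 rfl]
  mul_mem' := by
    intro a b ha hb
    have hpos : (0 : WithTop ℤ) < S.nu ((b : E) - 1) :=
      lt_of_lt_of_le (by exact_mod_cast (by omega : (0 : ℤ) < (r : ℤ) + 1)) hb
    have h := S.nu_add (((a : E) - 1) * b) ((b : E) - 1)
    rw [S.nu_mul, S.nu_eq_zero_of_pos_nu_sub_one hpos, add_zero,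
      show ((a : E) - 1) * b + (b - 1) = a * b - 1 by ring] at h
    exact (le_min ha hb).trans h
  inv_mem' := by
    intro a ha
    have hpos : (0 : WithTop ℤ) < S.nu ((a : E) - 1) :=
      lt_of_lt_of_le (by exact_mod_cast (by omega : (0 : ℤ) < (r : ℤ) + 1)) ha
    have h := S.nu_mul ((a⁻¹ : Eˣ) - 1 : E) a
    rw [S.nu_eq_zero_of_pos_nu_sub_one hpos, add_zero, sub_mul, Units.inv_mul, one_mul,
      ← neg_sub, S.nu_neg] at h
    exact le_of_le_of_eq ha h

/-- The homomorphism `a ↦ a σ(a)⁻¹` on `E^×`. -/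
def divSig (S : USetting E) : Eˣ →* Eˣ := MonoidHom.id Eˣ / Units.map S.sig.toMonoidHom

theorem coe_divSig (S : USetting E) (u : Eˣ) :
    (S.divSig u : E) = u * (S.sig u)⁻¹ := by
  simp [divSig, div_eq_mul_inv]

theorem divSig_eq_one_iff (S : USetting E) (u : Eˣ) : S.divSig u = 1 ↔ S.sig (u : E) = u := by
  rw [divSig, MonoidHom.div_apply, div_eq_one, Units.ext_iff, eq_comm]
  rfl

end USetting

/-- The group homomorphism `E^× → ℂ^×` attached to a character. -/
def IsChar.toHom {χ : E → ℂ} (hχ : IsChar χ) : Eˣ →* ℂˣ :=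
  MonoidHom.mk' (fun u => Units.mk0 (χ u) (hχ.2 u u.ne_zero))
    fun a b => Units.ext (hχ.1 a b a.ne_zero b.ne_zero)

theorem IsChar.coe_toHom {χ : E → ℂ} (hχ : IsChar χ) (u : Eˣ) : (hχ.toHom u : ℂ) = χ u := rfl

/-- The extension by zero to `E` of a homomorphism `E^× → ℂ^×`. -/
def extendZero (g : Eˣ →* ℂˣ) (x : E) : ℂ :=
  open Classical in if h : x = 0 then 0 else g (Units.mk0 x h)

theorem extendZero_coe (g : Eˣ →* ℂˣ) (u : Eˣ) : extendZero g u = g u := by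
  simp [extendZero]

theorem isChar_extendZero (g : Eˣ →* ℂˣ) : IsChar (extendZero g) := by
  refine ⟨fun x y hx hy => ?_, fun x hx => ?_⟩
  · lift x to Eˣ using hx.isUnit
    lift y to Eˣ using hy.isUnit
    rw [← Units.val_mul, extendZero_coe, extendZero_coe, extendZero_coe, map_mul, Units.val_mul]
  · lift x to Eˣ using hx.isUnit
    rw [extendZero_coe]
    exact Units.ne_zero _

/-- every character `χ` of `E^×` of true depth `r` is of the form
`χ(a) = φ(a σ(a)⁻¹) · χ'(a)` with `φ` a homomorphism of `E^1` and `χ'` of minimal depth `r`. -/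
theorem stmt3 (S : USetting E) (r : ℕ) (χ : E → ℂ) (hχ : IsChar χ)
    (hdep : HasTrueDepth S χ r) :
    ∃ φ χ' : E → ℂ, IsE1Hom S φ ∧ IsChar χ' ∧ MinDepth S χ' r ∧
      ∀ a : E, a ≠ 0 → χ a = φ (a * (S.sig a)⁻¹) * χ' a := by
  have hpos : (0 : WithTop ℤ) < (((r : ℤ) + 1 : ℤ) : WithTop ℤ) := by
    exact_mod_cast (by omega : (0 : ℤ) < (r : ℤ) + 1)
  obtain ⟨φ, hφ⟩ := exists_comp_eq_of_ker_le (S.divSig.comp (S.principalUnits r).subtype)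
    (hχ.toHom.comp (S.principalUnits r).subtype) fun u hu =>
      Units.ext (hdep.1 (u : Eˣ) ⟨(S.divSig_eq_one_iff u).1 hu, u.2⟩)
  have hφc := isChar_extendZero φ
  have hE1 : ∀ x ∈ E1set S, x ≠ 0 := by
    rintro x hx rfl
    simp [E1set] at hx
  set χ' : Eˣ →* ℂˣ := hχ.toHom / φ.comp S.divSig with hχ'
  have hmul : ∀ u : Eˣ, χ u = φ (S.divSig u) * χ' u := by
    intro u
    rw [← hχ.coe_toHom, ← Units.val_mul, hχ', MonoidHom.div_apply, MonoidHom.comp_apply,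
      mul_div_cancel]
  have hfix : ∀ x : E, x ≠ 0 → S.sig x = x → extendZero χ' x = χ x := by
    intro x hx hs
    lift x to Eˣ using hx.isUnit
    rw [extendZero_coe, hmul, (S.divSig_eq_one_iff x).2 hs, map_one, Units.val_one, one_mul]
  have htriv : TrivOn (extendZero χ') (onePE S ((r : ℤ) + 1)) := by
    intro x hx
    lift x to Eˣ using (S.ne_zero_of_pos_nu_sub_one (hpos.trans_le hx)).isUnit
    have h : φ (S.divSig x) = hχ.toHom x := hφ ⟨x, hx⟩
    rw [extendZero_coe, hχ', MonoidHom.div_apply, MonoidHom.comp_apply, h, div_self',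
      Units.val_one]
  have hnontriv : r = 0 ∨ ¬ TrivOn (extendZero χ') (onePF S (r : ℤ)) := by
    rcases Nat.eq_zero_or_pos r with hr | hr
    · exact Or.inl hr
    · refine Or.inr fun ht => hdep.2.resolve_left hr.ne' fun x hx => ?_
      have hx0 : x ≠ 0 :=
        S.ne_zero_of_pos_nu_sub_one (lt_of_lt_of_le (by exact_mod_cast hr) hx.2)
      rw [← hfix x hx0 hx.1]
      exact ht x hx
  refine ⟨extendZero φ, extendZero χ',
    ⟨fun x hx y hy => hφc.1 x y (hE1 x hx) (hE1 y hy), fun x hx => hφc.2 x (hE1 x hx)⟩,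
    isChar_extendZero χ',
    ⟨⟨htriv, hnontriv.imp_right fun hn ht => hn fun x hx => ht x hx.2⟩,
      fun x hx => htriv x hx.2, hnontriv⟩, fun a ha => ?_⟩
  lift a to Eˣ using ha.isUnit
  rw [← S.coe_divSig, extendZero_coe, extendZero_coe, hmul]
end
end

section
/- Let χ be a character of T of depth r whose restriction to O_E^× is nontrivial. Then V_χ^{K_n} = {0} for every integer n with 0 ≤ n ≤ r. -/
open Matrix

noncomputable section

variable {E : Type} [Field E]

theorem w0_mul_w0 : w0 E * w0 E = 1 := by
  ext i j; fin_cases i <;> fin_cases j <;> simp [w0]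

namespace USetting

theorem nu_neg_one (S : USetting E) : S.nu (-1) = 0 := by
  have h := S.nu_mul (-1) (-1)
  have ht : S.nu (-1) ≠ ⊤ := fun h => neg_ne_zero.2 one_ne_zero ((S.nu_eq_top (-1)).1 h)
  rw [neg_mul_neg, one_mul, S.nu_one] at h
  lift S.nu (-1) to ℤ using ht with m
  norm_cast at *
  grind

theorem nu_zero (S : USetting E) : S.nu 0 = ⊤ := (S.nu_eq_top 0).2 rfl

theorem ne_zero_of_nu_eq_zero (S : USetting E) {x : E} (h : S.nu x = 0) : x ≠ 0 := by
  rintro rfl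
  simp [S.nu_zero] at h

theorem nu_inv (S : USetting E) {x : E} (h : S.nu x = 0) : S.nu x⁻¹ = 0 := by
  have h1 := S.nu_mul x x⁻¹
  rw [mul_inv_cancel₀ (S.ne_zero_of_nu_eq_zero h), S.nu_one, h, zero_add] at h1
  exact h1.symm

theorem nu_eq_zero_of_one_le_nu_sub_one (S : USetting E) {x : E} (h : 1 ≤ S.nu (x - 1)) :
    S.nu x = 0 := by
  apply le_antisymm
  · have h1 := S.nu_add x (-(x - 1))
    rw [S.nu_neg, show x + -(x - 1) = 1 by ring, S.nu_one] at h1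
    rcases min_le_iff.1 h1 with h2 | h2
    · exact h2
    · exact absurd (h.trans h2) (by decide)
  · have h1 := S.nu_add (x - 1) 1
    rw [sub_add_cancel, S.nu_one] at h1
    exact (le_min (zero_le_one.trans h) le_rfl).trans h1

theorem le_nu_add (S : USetting E) {c : WithTop ℤ} {x y : E} (hx : c ≤ S.nu x)
    (hy : c ≤ S.nu y) : c ≤ S.nu (x + y) :=
  (le_min hx hy).trans (S.nu_add x y)

theorem le_nu_mul_apply (S : USetting E) {c d : WithTop ℤ} {A B : Mat E}
    (hA : ∀ i j, c ≤ S.nu (A i j)) (hB : ∀ i j, d ≤ S.nu (B i j)) (i j : Fin 2) :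
    c + d ≤ S.nu ((A * B) i j) := by
  rw [Matrix.mul_apply, Fin.sum_univ_two]
  apply S.le_nu_add <;> rw [S.nu_mul] <;> exact add_le_add (hA _ _) (hB _ _)

/-- The image of `a` in the diagonal torus, `diag(a, σ(a)⁻¹)`. -/
def torus (S : USetting E) (a : E) : Mat E := !![a, 0; 0, (S.sig a)⁻¹]

/-- The adjoint `w₀ σ(k)ᵀ w₀`, which is the inverse of `k` when `k` is unitary. -/
def adj (S : USetting E) (k : Mat E) : Mat E := w0 E * (k.map ⇑S.sig)ᵀ * w0 E

theorem adj_mul_self (S : USetting E) {k : Mat E} (hk : k ∈ Gset S) : S.adj k * k = 1 := by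
  have h : (k.map ⇑S.sig)ᵀ * w0 E * k = w0 E := hk
  rw [adj, Matrix.mul_assoc, Matrix.mul_assoc, ← Matrix.mul_assoc _ (w0 E) k, h, w0_mul_w0]

theorem mul_mem_Gset (S : USetting E) {g h : Mat E} (hg : g ∈ Gset S) (hh : h ∈ Gset S) :
    g * h ∈ Gset S := by
  have hg' : (g.map ⇑S.sig)ᵀ * w0 E * g = w0 E := hg
  have hh' : (h.map ⇑S.sig)ᵀ * w0 E * h = w0 E := hh
  change ((g * h).map ⇑S.sig)ᵀ * w0 E * (g * h) = w0 E
  rw [Matrix.map_mul, Matrix.transpose_mul]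
  calc _ = (h.map ⇑S.sig)ᵀ * ((g.map ⇑S.sig)ᵀ * w0 E * g) * h := by simp only [Matrix.mul_assoc]
    _ = w0 E := by rw [hg', hh']

theorem adj_mem_Gset (S : USetting E) {k : Mat E} (hk : k ∈ Gset S) : S.adj k ∈ Gset S := by
  have hk' : (k.map ⇑S.sig)ᵀ * w0 E * k = w0 E := hk
  have h1 : k * S.adj k = 1 := mul_eq_one_comm.1 (S.adj_mul_self hk)
  have h2 : ((S.adj k).map ⇑S.sig)ᵀ * (k.map ⇑S.sig)ᵀ = 1 := by
    rw [← Matrix.transpose_mul, ← Matrix.map_mul, h1, Matrix.map_one _ (map_zero _) (map_one _),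
      Matrix.transpose_one]
  change ((S.adj k).map ⇑S.sig)ᵀ * w0 E * S.adj k = w0 E
  calc _ = ((S.adj k).map ⇑S.sig)ᵀ * ((k.map ⇑S.sig)ᵀ * w0 E * k) * S.adj k := by rw [hk']
    _ = (((S.adj k).map ⇑S.sig)ᵀ * (k.map ⇑S.sig)ᵀ) * w0 E * (k * S.adj k) := by
      simp only [Matrix.mul_assoc]
    _ = w0 E := by rw [h1, h2, Matrix.one_mul, Matrix.mul_one]

theorem nu_adj_nonneg (S : USetting E) {k : Mat E} (hk : ∀ i j, 0 ≤ S.nu (k i j)) (i j : Fin 2) :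
    0 ≤ S.nu (S.adj k i j) := by
  have hw : ∀ i j, 0 ≤ S.nu (w0 E i j) := fun i j => by
    fin_cases i <;> fin_cases j <;> simp [w0, S.nu_zero, S.nu_one]
  have hs : ∀ i j, 0 ≤ S.nu ((k.map ⇑S.sig)ᵀ i j) := fun i j => by
    simpa [S.nu_sig] using hk j i
  simpa [adj] using S.le_nu_mul_apply (S.le_nu_mul_apply hw hs) hw i j

theorem torus_mem_Bcal (S : USetting E) {a : E} (ha : S.nu a = 0) : S.torus a ∈ Bcal S := by
  have ha0 := S.ne_zero_of_nu_eq_zero ha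
  have hs : S.nu (S.sig a) = 0 := (S.nu_sig a).trans ha
  have hs0 := S.ne_zero_of_nu_eq_zero hs
  refine ⟨⟨?_, fun i j => ?_, ?_⟩, rfl⟩
  · change ((S.torus a).map ⇑S.sig)ᵀ * w0 E * S.torus a = w0 E
    ext i j
    fin_cases i <;> fin_cases j <;>
      simp [torus, w0, Matrix.mul_apply, S.sig_invol, ha0, hs0]
  · fin_cases i <;> fin_cases j <;> simp [torus, ha, S.nu_inv hs, S.nu_zero]
  · simp [torus, Matrix.det_fin_two, S.nu_mul, ha, S.nu_inv hs]

theorem le_nu_torus_sub_one (S : USetting E) {a : E} (ha : S.nu a = 0) {c : WithTop ℤ}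
    (hc : c ≤ S.nu (a - 1)) (i j : Fin 2) : c ≤ S.nu ((S.torus a - 1) i j) := by
  have hs : S.nu (S.sig a) = 0 := (S.nu_sig a).trans ha
  have hs0 := S.ne_zero_of_nu_eq_zero hs
  have h : S.nu ((S.sig a)⁻¹ - 1) = S.nu (a - 1) := by
    rw [show (S.sig a)⁻¹ - 1 = (S.sig a)⁻¹ * -S.sig (a - 1) by
        rw [map_sub, map_one]; field_simp; ring,
      S.nu_mul, S.nu_neg, S.nu_sig, S.nu_inv hs, zero_add]
  fin_cases i <;> fin_cases j <;> simp [torus, hc, h, S.nu_zero]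

/-- `K_n` is normalized by `K`. -/
theorem conj_mem_Kfil (S : USetting E) {n : ℤ} {k b : Mat E} (hk : k ∈ Kset S)
    (hb : b ∈ Kfil S n) : S.adj k * b * k ∈ Kfil S n := by
  obtain ⟨hkG, hki, -⟩ := hk
  obtain ⟨⟨hbG, hbi, hbd⟩, hbn⟩ := hb
  have hadj := S.adj_mul_self hkG
  have hai := S.nu_adj_nonneg hki
  refine ⟨⟨S.mul_mem_Gset (S.mul_mem_Gset (S.adj_mem_Gset hkG) hbG) hkG, fun i j => ?_, ?_⟩,
    fun i j => ?_⟩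
  · simpa using S.le_nu_mul_apply (S.le_nu_mul_apply hai hbi) hki i j
  · have h : (S.adj k * b * k).det = b.det := by
      have hd : (S.adj k).det * k.det = 1 := by rw [← Matrix.det_mul, hadj, Matrix.det_one]
      rw [Matrix.det_mul, Matrix.det_mul]
      linear_combination b.det * hd
    rw [h, hbd]
  · have h : S.adj k * b * k - 1 = S.adj k * (b - 1) * k := by
      rw [Matrix.mul_sub, Matrix.sub_mul, Matrix.mul_one, hadj]
    rw [h]
    simpa using S.le_nu_mul_apply (S.le_nu_mul_apply hai hbn) hki i j

/-- A function in `V_χ^{K_n}` vanishes once `χ` is nontrivial on a unit in `1 + p_E^n`. -/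
theorem Vsp_eq_bot (S : USetting E) {χ : E → ℂ} {n : ℤ} {a : E} (ha : S.nu a = 0)
    (han : (n : WithTop ℤ) ≤ S.nu (a - 1)) (hχa : χ a ≠ 1) : Vsp S χ n = ⊥ := by
  rw [eq_bot_iff]
  rintro f ⟨hf0, hf1, hf2⟩
  rw [Submodule.mem_bot]
  funext k
  by_cases hk : k ∈ Kset S
  · have hb := S.torus_mem_Bcal ha
    have h1 := hf1 _ hb k hk
    have h2 := hf2 k hk _ (S.conj_mem_Kfil hk ⟨hb.1, S.le_nu_torus_sub_one ha han⟩)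
    have h3 : k * (S.adj k * S.torus a * k) = S.torus a * k := by
      rw [← Matrix.mul_assoc, ← Matrix.mul_assoc, mul_eq_one_comm.1 (S.adj_mul_self hk.1),
        Matrix.one_mul]
    rw [h3, h1] at h2
    exact (mul_left_eq_self₀.1 h2).resolve_left hχa
  · exact hf0 k hk

end USetting

/-- if `χ` has depth `r` and is nontrivial on `O_E^×`, then
`V_χ^{K_n} = {0}` for all `0 ≤ n ≤ r`. -/
theorem stmt5 (S : USetting E) (χ : E → ℂ) (hχ : IsChar χ) (r : ℕ)
    (hdep : HasDepth S χ r) (hnt : ∃ x ∈ OEunits S, χ x ≠ 1) :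
    ∀ n : ℕ, n ≤ r → Vsp S χ (n : ℤ) = ⊥ := by
  intro n hn
  rcases Nat.eq_zero_or_pos r with rfl | hr
  · obtain ⟨x, hx, hχx⟩ := hnt
    have hx0 : S.nu x = 0 := hx
    obtain rfl := Nat.le_zero.1 hn
    refine S.Vsp_eq_bot hx0 ?_ hχx
    rw [sub_eq_add_neg]
    exact S.le_nu_add (by simp [hx0]) (by simp [S.nu_neg_one])
  · have h := hdep.2.resolve_left hr.ne'
    rw [TrivOn] at h
    push Not at h
    obtain ⟨x, hx, hχx⟩ := h
    have hx' : (((r : ℤ)) : WithTop ℤ) ≤ S.nu (x - 1) := hx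
    refine S.Vsp_eq_bot (S.nu_eq_zero_of_one_le_nu_sub_one (le_trans ?_ hx'))
      (le_trans ?_ hx') hχx
    · exact_mod_cast hr
    · exact_mod_cast hn
end
end
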